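/- arXiv:1303.4246 — 5 statements merged into one kernel-verified Lean document; each statement's English description precedes it below -/
import Mathlib

section
/- Let ℓ > 0. There exists a constant C_p > 0 (one may take C_p = ℓ²) such that for every continuously differentiable function v : [0,ℓ] → ℝ with v(ℓ) = 0, the weighted Poincaré-type inequality ∫₀^ℓ x·v(x)² dx ≤ C_p ∫₀^ℓ x·v'(x)² dx holds. -/
open MeasureTheory

/-- Weighted Poincaré-type inequality (Lemma 2.1): for `ℓ > 0` there is `C_p > 0`
(one may take `C_p = ℓ²`) such that every `C¹` function `v` on `[0,ℓ]` with `v ℓ = 0`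
satisfies `∫₀^ℓ x v(x)² dx ≤ C_p ∫₀^ℓ x v'(x)² dx`. -/
theorem weighted_poincare (ℓ : ℝ) (hℓ : 0 < ℓ) :
    ∃ Cp : ℝ, 0 < Cp ∧ Cp = ℓ ^ 2 ∧
      ∀ v : ℝ → ℝ, ContDiffOn ℝ 1 v (Set.Icc 0 ℓ) → v ℓ = 0 →
        (∫ x in (0:ℝ)..ℓ, x * v x ^ 2) ≤ Cp * ∫ x in (0:ℝ)..ℓ, x * (deriv v x) ^ 2 := by
  refine ⟨ℓ ^ 2, by positivity, rfl, fun v hv hvℓ => ?_⟩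
  set g := derivWithin v (Set.Icc 0 ℓ)
  have hgc : ContinuousOn g (Set.Icc 0 ℓ) :=
    hv.continuousOn_derivWithin (uniqueDiffOn_Icc hℓ) le_rfl
  have hvc : ContinuousOn v (Set.Icc 0 ℓ) := hv.continuousOn
  have hd : ∀ x ∈ Set.Ioo 0 ℓ, HasDerivAt v (g x) x := fun x hx =>
    ((hv.differentiableOn one_ne_zero x (Set.Ioo_subset_Icc_self hx)).hasDerivWithinAt).hasDerivAt
      (Icc_mem_nhds hx.1 hx.2)
  have hcongr : ∫ x in (0:ℝ)..ℓ, x * (deriv v x) ^ 2 = ∫ x in (0:ℝ)..ℓ, x * g x ^ 2 :=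
    intervalIntegral.integral_congr_Ioo_of_le hℓ.le fun x hx => by simp only [(hd x hx).deriv]
  have hi : ∀ {f : ℝ → ℝ}, ContinuousOn f (Set.Icc 0 ℓ) → IntervalIntegrable f volume 0 ℓ :=
    fun hf => hf.intervalIntegrable_of_Icc hℓ.le
  have hi₁ : IntervalIntegrable (fun x => x * v x ^ 2) volume 0 ℓ := hi (by fun_prop)
  have hi₂ : IntervalIntegrable (fun x => ℓ ^ 2 * (x * g x ^ 2)) volume 0 ℓ := hi (by fun_prop)
  have hi₃ : IntervalIntegrable (fun x => 2 * x * v x ^ 2 + x ^ 2 * (2 * v x * g x)) volume 0 ℓ :=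
    hi (by fun_prop)
  have hzero : ∫ x in (0:ℝ)..ℓ, (2 * x * v x ^ 2 + x ^ 2 * (2 * v x * g x)) = 0 := by
    rw [intervalIntegral.integral_eq_sub_of_hasDerivAt_of_le (f := fun x => x ^ 2 * v x ^ 2) hℓ.le
      (by fun_prop) (fun x hx => ?_) hi₃]
    · simp [hvℓ]
    · simpa using (hasDerivAt_pow 2 x).fun_mul ((hd x hx).fun_pow 2)
  rw [hcongr, ← intervalIntegral.integral_const_mul]
  calc ∫ x in (0:ℝ)..ℓ, x * v x ^ 2
      ≤ ∫ x in (0:ℝ)..ℓ, (ℓ ^ 2 * (x * g x ^ 2) +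
          (2 * x * v x ^ 2 + x ^ 2 * (2 * v x * g x))) := by
        refine intervalIntegral.integral_mono_on hℓ.le hi₁ (hi₂.add hi₃) fun x hx => ?_
        have h₁ : 0 ≤ x * (v x + x * g x) ^ 2 := mul_nonneg hx.1 (sq_nonneg _)
        have h₂ : x ^ 2 * (x * g x ^ 2) ≤ ℓ ^ 2 * (x * g x ^ 2) :=
          mul_le_mul_of_nonneg_right (pow_le_pow_left₀ hx.1 hx.2 2)
            (mul_nonneg hx.1 (sq_nonneg _))
        linarith
    _ = ∫ x in (0:ℝ)..ℓ, ℓ ^ 2 * (x * g x ^ 2) := by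
        rw [intervalIntegral.integral_add hi₂ hi₃, hzero, add_zero]
end

section
/- Let ℓ > 0 and 2 < p < 4. There exists a constant C* > 0, depending only on ℓ and p, such that for every continuously differentiable function v : [0,ℓ] → ℝ with v(ℓ) = 0, one has ∫₀^ℓ x·|v(x)|^p dx ≤ C* (∫₀^ℓ x·v'(x)² dx)^{p/2}. -/
open MeasureTheory

/-- Cauchy–Schwarz for the integral of a continuous derivative. -/
theorem sq_sub_le_mul_integral_sq {v w : ℝ → ℝ} {a b : ℝ} (hab : a ≤ b)
    (hv : ContinuousOn v (Set.Icc a b)) (hw : ContinuousOn w (Set.Icc a b))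
    (hd : ∀ x ∈ Set.Ioo a b, HasDerivAt v (w x) x) :
    (v b - v a) ^ 2 ≤ (b - a) * ∫ x in a..b, w x ^ 2 := by
  rcases hab.eq_or_lt with rfl | hlt
  · simp
  have hw' : ContinuousOn w (Set.uIcc a b) := by rwa [Set.uIcc_of_le hab]
  have hiw : IntervalIntegrable w volume a b := hw'.intervalIntegrable
  have hiw2 : IntervalIntegrable (fun x => w x ^ 2) volume a b :=
    (hw'.pow 2).intervalIntegrable
  have hD : ∫ x in a..b, w x = v b - v a :=
    intervalIntegral.integral_eq_sub_of_hasDerivAt_of_le hab hv hd hiw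
  set D := v b - v a
  have h0 : 0 ≤ ∫ x in a..b, ((b - a) * w x - D) ^ 2 :=
    intervalIntegral.integral_nonneg hab fun x _ => sq_nonneg _
  have h1 : ∫ x in a..b, ((b - a) * w x - D) ^ 2
      = (b - a) ^ 2 * (∫ x in a..b, w x ^ 2) - 2 * (b - a) * D * D + (b - a) * D ^ 2 := by
    have : ∀ x, ((b - a) * w x - D) ^ 2
        = (b - a) ^ 2 * w x ^ 2 - 2 * (b - a) * D * w x + D ^ 2 := fun x => by ring
    simp_rw [this]
    rw [intervalIntegral.integral_add ((hiw2.const_mul _).sub (hiw.const_mul _))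
        intervalIntegrable_const,
      intervalIntegral.integral_sub (hiw2.const_mul _) (hiw.const_mul _),
      intervalIntegral.integral_const_mul, intervalIntegral.integral_const_mul, hD,
      intervalIntegral.integral_const, smul_eq_mul]
  rw [h1] at h0
  have hpos : 0 < b - a := sub_pos.2 hlt
  refine le_of_mul_le_mul_left ?_ hpos
  nlinarith

/-- A continuously differentiable function vanishing at the right endpoint grows at most like
`x ^ (-1/2)` at the origin, with constant given by the weighted energy. -/
theorem mul_sq_le_mul_integral_mul_sq {v w : ℝ → ℝ} {l x : ℝ} (hx : 0 < x) (hxl : x ≤ l)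
    (hv : ContinuousOn v (Set.Icc 0 l)) (hw : ContinuousOn w (Set.Icc 0 l))
    (hd : ∀ y ∈ Set.Ioo 0 l, HasDerivAt v (w y) y) (hvl : v l = 0) :
    x * v x ^ 2 ≤ l * ∫ y in (0 : ℝ)..l, y * w y ^ 2 := by
  have hsub : Set.Icc x l ⊆ Set.Icc 0 l := Set.Icc_subset_Icc_left hx.le
  have hcs := sq_sub_le_mul_integral_sq hxl (hv.mono hsub) (hw.mono hsub)
    fun y hy => hd y ⟨hx.trans hy.1, hy.2⟩
  rw [hvl, zero_sub, neg_sq] at hcs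
  have hcont : ContinuousOn (fun y => y * w y ^ 2) (Set.Icc 0 l) :=
    continuousOn_id.mul (hw.pow 2)
  have hint : IntervalIntegrable (fun y => y * w y ^ 2) volume 0 l :=
    ContinuousOn.intervalIntegrable (by rwa [Set.uIcc_of_le (hx.le.trans hxl)])
  have hintx : IntervalIntegrable (fun y => y * w y ^ 2) volume x l :=
    ContinuousOn.intervalIntegrable (by rw [Set.uIcc_of_le hxl]; exact hcont.mono hsub)
  have hintw : IntervalIntegrable (fun y => w y ^ 2) volume x l :=
    ContinuousOn.intervalIntegrable (by rw [Set.uIcc_of_le hxl]; exact (hw.mono hsub).pow 2)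
  have h1 : x * ∫ y in x..l, w y ^ 2 ≤ ∫ y in x..l, y * w y ^ 2 := by
    rw [← intervalIntegral.integral_const_mul]
    exact intervalIntegral.integral_mono_on hxl (hintw.const_mul _) hintx
      fun y hy => mul_le_mul_of_nonneg_right hy.1 (sq_nonneg _)
  have h2 : ∫ y in x..l, y * w y ^ 2 ≤ ∫ y in (0 : ℝ)..l, y * w y ^ 2 := by
    refine intervalIntegral.integral_mono_interval hx.le hxl le_rfl ?_ hint
    filter_upwards [ae_restrict_mem measurableSet_Ioc] with y hy
    exact mul_nonneg hy.1.le (sq_nonneg _)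
  have h3 : 0 ≤ ∫ y in x..l, y * w y ^ 2 :=
    intervalIntegral.integral_nonneg hxl fun y hy =>
      mul_nonneg (hx.le.trans hy.1) (sq_nonneg _)
  calc x * v x ^ 2 ≤ x * ((l - x) * ∫ y in x..l, w y ^ 2) := by gcongr
    _ = (l - x) * (x * ∫ y in x..l, w y ^ 2) := by ring
    _ ≤ (l - x) * ∫ y in x..l, y * w y ^ 2 :=
      mul_le_mul_of_nonneg_left h1 (sub_nonneg.2 hxl)
    _ ≤ l * ∫ y in x..l, y * w y ^ 2 := mul_le_mul_of_nonneg_right (by linarith) h3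
    _ ≤ l * ∫ y in (0 : ℝ)..l, y * w y ^ 2 :=
      mul_le_mul_of_nonneg_left h2 (hx.le.trans hxl)

/-- Weighted Sobolev-type embedding (Lemma 2.2): for `ℓ > 0` and `2 < p < 4` there is a
constant `C* > 0`, depending only on `ℓ` and `p`, such that every `C¹` function `v` on
`[0,ℓ]` with `v ℓ = 0` satisfies `∫₀^ℓ x |v(x)|^p dx ≤ C* (∫₀^ℓ x v'(x)² dx)^{p/2}`. -/
theorem weighted_embedding (ℓ p : ℝ) (hℓ : 0 < ℓ) (hp2 : 2 < p) (hp4 : p < 4) :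
    ∃ Cstar : ℝ, 0 < Cstar ∧
      ∀ v : ℝ → ℝ, ContDiffOn ℝ 1 v (Set.Icc 0 ℓ) → v ℓ = 0 →
        (∫ x in (0:ℝ)..ℓ, x * |v x| ^ p) ≤
          Cstar * (∫ x in (0:ℝ)..ℓ, x * (deriv v x) ^ 2) ^ (p / 2) := by
  have hexp : -1 < 1 - p / 2 := by linarith
  have hpow : IntervalIntegrable (fun x : ℝ => x ^ (1 - p / 2)) volume 0 ℓ :=
    intervalIntegral.intervalIntegrable_rpow' hexp
  refine ⟨ℓ ^ (p / 2) * ∫ x in (0 : ℝ)..ℓ, x ^ (1 - p / 2), ?_, ?_⟩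
  · refine mul_pos (Real.rpow_pos_of_pos hℓ _) ?_
    exact intervalIntegral.intervalIntegral_pos_of_pos_on hpow
      (fun x hx => Real.rpow_pos_of_pos hx.1 _) hℓ
  intro v hv hvl
  set w := derivWithin v (Set.Icc 0 ℓ) with hwdef
  have hw : ContinuousOn w (Set.Icc 0 ℓ) :=
    hv.continuousOn_derivWithin (uniqueDiffOn_Icc hℓ) le_rfl
  have hd : ∀ x ∈ Set.Ioo 0 ℓ, HasDerivAt v (w x) x := fun x hx =>
    ((hv.differentiableOn one_ne_zero x (Set.Ioo_subset_Icc_self hx)).hasDerivWithinAt).hasDerivAt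
      (Icc_mem_nhds hx.1 hx.2)
  have hI : ∫ x in (0 : ℝ)..ℓ, x * deriv v x ^ 2 = ∫ x in (0 : ℝ)..ℓ, x * w x ^ 2 := by
    refine intervalIntegral.integral_congr_ae ?_
    filter_upwards [Measure.ae_ne volume ℓ] with x hx hmem
    rw [Set.uIoc_of_le hℓ.le] at hmem
    rw [(hd x ⟨hmem.1, lt_of_le_of_ne hmem.2 hx⟩).deriv]
  rw [hI]
  set I := ∫ x in (0 : ℝ)..ℓ, x * w x ^ 2
  have hI0 : 0 ≤ I := intervalIntegral.integral_nonneg hℓ.le fun x hx =>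
    mul_nonneg hx.1 (sq_nonneg _)
  have hleft : IntervalIntegrable (fun x => x * |v x| ^ p) volume 0 ℓ := by
    refine ContinuousOn.intervalIntegrable ?_
    rw [Set.uIcc_of_le hℓ.le]
    exact continuousOn_id.mul
      (hv.continuousOn.abs.rpow_const fun x _ => Or.inr (by linarith))
  have hpt : ∀ x ∈ Set.Ioo 0 ℓ,
      x * |v x| ^ p ≤ (ℓ ^ (p / 2) * I ^ (p / 2)) * x ^ (1 - p / 2) := by
    intro x hx
    have hsq : v x ^ 2 ≤ ℓ * I / x := by
      rw [le_div_iff₀ hx.1, mul_comm]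
      exact mul_sq_le_mul_integral_mul_sq hx.1 hx.2.le hv.continuousOn hw hd hvl
    calc x * |v x| ^ p = x * (v x ^ 2) ^ (p / 2) := by
          rw [← sq_abs, ← Real.rpow_natCast, ← Real.rpow_mul (abs_nonneg _)]
          congr 2
          push_cast
          ring
      _ ≤ x * (ℓ * I / x) ^ (p / 2) :=
          mul_le_mul_of_nonneg_left
            (Real.rpow_le_rpow (sq_nonneg _) hsq (by linarith)) hx.1.le
      _ = (ℓ ^ (p / 2) * I ^ (p / 2)) * x ^ (1 - p / 2) := by
          rw [Real.div_rpow (mul_nonneg hℓ.le hI0) hx.1.le, Real.mul_rpow hℓ.le hI0,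
            Real.rpow_sub hx.1, Real.rpow_one]
          ring
  calc ∫ x in (0 : ℝ)..ℓ, x * |v x| ^ p
      ≤ ∫ x in (0 : ℝ)..ℓ, (ℓ ^ (p / 2) * I ^ (p / 2)) * x ^ (1 - p / 2) :=
        intervalIntegral.integral_mono_on_of_le_Ioo hℓ.le hleft (hpow.const_mul _) hpt
    _ = (ℓ ^ (p / 2) * ∫ x in (0 : ℝ)..ℓ, x ^ (1 - p / 2)) * I ^ (p / 2) := by
        rw [intervalIntegral.integral_const_mul]
        ring
end

section
/- Let ζ > 0 and T > 0, and let L : [0,T] → ℝ be a twice continuously differentiable function with L(t) > 0 for all t ∈ [0,T], satisfying L(t)·L''(t) − (1+ζ)·L'(t)² ≥ 0 for all t ∈ (0,T), together with L(0) > 0 and L'(0) > 0. Then T < L(0)/(ζ·L'(0)). Equivalently, any such L defined on [0,T*) with T* = L(0)/(ζ·L'(0)) must satisfy lim_{t→T*⁻} L(t) = +∞. -/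
open Set in
/-- A positive function `L` on `[0, T]` with interior derivatives `L' = M`, `M' = N` satisfying
`L * N ≥ (1 + ζ) * M ^ 2` and `0 < M 0` has `L ^ (-ζ)` below its tangent line at `0`, hence
`T < L 0 / (ζ * M 0)`. -/
theorem concavity_lifespan_bound {ζ T : ℝ} (hζ : 0 < ζ) (hT : 0 < T) {L M N : ℝ → ℝ}
    (hLc : ContinuousOn L (Icc 0 T)) (hMc : ContinuousOn M (Icc 0 T))
    (hL : ∀ t ∈ Ioo 0 T, HasDerivAt L (M t) t) (hM : ∀ t ∈ Ioo 0 T, HasDerivAt M (N t) t)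
    (hpos : ∀ t ∈ Icc 0 T, 0 < L t)
    (hineq : ∀ t ∈ Ioo 0 T, 0 ≤ L t * N t - (1 + ζ) * M t ^ 2) (hM0 : 0 < M 0) :
    T < L 0 / (ζ * M 0) := by
  have h0 : (0 : ℝ) ∈ Icc 0 T := ⟨le_rfl, hT.le⟩
  have hT' : T ∈ Icc 0 T := ⟨hT.le, le_rfl⟩
  have hrpow (p : ℝ) : ContinuousOn (fun t => L t ^ p) (Icc 0 T) :=
    hLc.rpow_const fun t ht => Or.inl (hpos t ht).ne'
  have hmono : MonotoneOn (fun t => M t * L t ^ (-ζ - 1)) (Icc 0 T) := by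
    refine monotoneOn_of_hasDerivWithinAt_nonneg (convex_Icc 0 T) (hMc.mul (hrpow _))
      (f' := fun t => L t ^ (-ζ - 1 - 1) * (L t * N t - (1 + ζ) * M t ^ 2)) ?_ ?_
    · rw [interior_Icc]
      intro t ht
      have hLt := hpos t (Ioo_subset_Icc_self ht)
      have hd := (hM t ht).mul ((hL t ht).rpow_const (p := -ζ - 1) (Or.inl hLt.ne'))
      refine (hd.congr_deriv ?_).hasDerivWithinAt
      have : L t ^ (-ζ - 1) = L t ^ (-ζ - 1 - 1) * L t := by
        rw [Real.rpow_sub_one hLt.ne' (-ζ - 1), div_mul_cancel₀ _ hLt.ne']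
      rw [this]
      ring
    · rw [interior_Icc]
      intro t ht
      exact mul_nonneg (Real.rpow_nonneg (hpos t (Ioo_subset_Icc_self ht)).le _) (hineq t ht)
  have hanti : AntitoneOn (fun t => L t ^ (-ζ) + ζ * (M 0 * L 0 ^ (-ζ - 1)) * t) (Icc 0 T) := by
    refine antitoneOn_of_hasDerivWithinAt_nonpos (convex_Icc 0 T)
      ((hrpow _).add (continuousOn_const.mul continuousOn_id))
      (f' := fun t => -ζ * (M t * L t ^ (-ζ - 1)) + ζ * (M 0 * L 0 ^ (-ζ - 1))) ?_ ?_
    · rw [interior_Icc]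
      intro t ht
      have hLt := hpos t (Ioo_subset_Icc_self ht)
      have hd := ((hL t ht).rpow_const (p := -ζ) (Or.inl hLt.ne')).add
        ((hasDerivAt_id t).const_mul (ζ * (M 0 * L 0 ^ (-ζ - 1))))
      exact (hd.congr_deriv (by ring)).hasDerivWithinAt
    · rw [interior_Icc]
      intro t ht
      have := mul_le_mul_of_nonneg_left (hmono h0 (Ioo_subset_Icc_self ht) ht.1.le) hζ.le
      dsimp only at this ⊢
      linarith
  have hle := hanti h0 hT' hT.le
  have hFT : 0 < L T ^ (-ζ) := Real.rpow_pos_of_pos (hpos T hT') _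
  have hL0 := hpos 0 h0
  have hfac : L 0 ^ (-ζ) = L 0 ^ (-ζ - 1) * L 0 := by
    rw [Real.rpow_sub_one hL0.ne', div_mul_cancel₀ _ hL0.ne']
  have hc : 0 < L 0 ^ (-ζ - 1) := Real.rpow_pos_of_pos hL0 _
  rw [lt_div_iff₀ (mul_pos hζ hM0)]
  refine lt_of_mul_lt_mul_left ?_ hc.le
  dsimp only at hle
  rw [hfac] at hle
  linarith

/-- Concavity blow-up lemma (Lemma 3.3, Levine): if `L` is a positive `C²` function on
`[0,T]` with `L·L'' − (1+ζ)(L')² ≥ 0` on `(0,T)`, `L(0) > 0` and `L'(0) > 0`, then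
`T < L(0)/(ζ·L'(0))`; i.e. such an `L` must blow up no later than `L(0)/(ζ L'(0))`. -/
theorem concavity_blowup (ζ T : ℝ) (hζ : 0 < ζ) (hT : 0 < T) (L : ℝ → ℝ)
    (hC2 : ContDiffOn ℝ 2 L (Set.Icc 0 T))
    (hpos : ∀ t ∈ Set.Icc (0:ℝ) T, 0 < L t)
    (hineq : ∀ t ∈ Set.Ioo (0:ℝ) T, 0 ≤ L t * deriv (deriv L) t - (1 + ζ) * (deriv L t) ^ 2)
    (hL0 : 0 < L 0) (hL0' : 0 < deriv L 0) :
    T < L 0 / (ζ * deriv L 0) := by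
  have hu : UniqueDiffOn ℝ (Set.Icc 0 T) := uniqueDiffOn_Icc hT
  have hnhds : ∀ t ∈ Set.Ioo 0 T, Set.Icc 0 T ∈ nhds t := fun t ht => Icc_mem_nhds ht.1 ht.2
  have heq : ∀ t ∈ Set.Ioo 0 T, derivWithin L (Set.Icc 0 T) t = deriv L t :=
    fun t ht => derivWithin_of_mem_nhds (hnhds t ht)
  have hM1 : ContDiffOn ℝ 1 (derivWithin L (Set.Icc 0 T)) (Set.Icc 0 T) :=
    hC2.derivWithin hu (by norm_num)
  -- A nonzero value of `deriv` at the endpoint forces two-sided differentiability there.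
  have hM0 : derivWithin L (Set.Icc 0 T) 0 = deriv L 0 :=
    (differentiableAt_of_deriv_ne_zero hL0'.ne').derivWithin (hu 0 ⟨le_rfl, hT.le⟩)
  rw [← hM0] at hL0' ⊢
  refine concavity_lifespan_bound (N := deriv (deriv L)) hζ hT hC2.continuousOn hM1.continuousOn
    (fun t ht => ?_) (fun t ht => ?_) hpos (fun t ht => ?_) hL0'
  · rw [heq t ht]
    exact ((hC2.differentiableOn (by norm_num)).differentiableAt (hnhds t ht)).hasDerivAt
  · have hev : derivWithin L (Set.Icc 0 T) =ᶠ[nhds t] deriv L :=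
      Filter.eventuallyEq_of_mem (Ioo_mem_nhds ht.1 ht.2) heq
    rw [← hev.deriv_eq]
    exact ((hM1.differentiableOn (by norm_num)).differentiableAt (hnhds t ht)).hasDerivAt
  · rw [heq t ht]
    exact hineq t ht
end

section
/- Let ℓ > 0, 2 < p < 4, and 0 < l ≤ 1, and let C* > 0 be a constant such that ∫₀^ℓ x|v|^p dx ≤ C*(∫₀^ℓ x v'(x)² dx)^{p/2} for all continuously differentiable v : [0,ℓ] → ℝ with v(ℓ) = 0. Let v be such a function with ∫₀^ℓ x|v|^p dx > 0, let κ ≥ l and G ≥ 0. Then sup_{λ ≥ 0} [ (λ²/2)(κ ∫₀^ℓ x v'(x)² dx + G) − (λ^p/p) ∫₀^ℓ x|v(x)|^p dx ] ≥ d₁, where d₁ = ((p−2)/(2p)) (l / C*^{2/p})^{p/(p−2)}. -/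
open MeasureTheory

/-- A fibering map `λ ↦ (λ²/2) M - (λ^p/p) B` with `p > 2` and `B > 0` is bounded above on
`[0, ∞)`. -/
theorem bddAbove_fibering {p M B : ℝ} (hp : 2 < p) (hM : 0 ≤ M) (hB : 0 < B) :
    BddAbove {y : ℝ | ∃ lam : ℝ, 0 ≤ lam ∧ y = lam ^ 2 / 2 * M - lam ^ p / p * B} := by
  have hp0 : 0 < p := by linarith
  have hq : 0 < p - 2 := by linarith
  set r : ℝ := (p * M / (2 * B)) ^ (1 / (p - 2)) with hr
  have hr0 : 0 ≤ r := by positivity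
  have hrp : r ^ (p - 2) = p * M / (2 * B) := by
    rw [hr, ← Real.rpow_mul (by positivity), one_div_mul_cancel hq.ne', Real.rpow_one]
  refine ⟨r ^ 2 / 2 * M, ?_⟩
  rintro y ⟨t, ht, rfl⟩
  rcases le_or_gt t r with h | h
  · have h1 : t ^ 2 / 2 * M ≤ r ^ 2 / 2 * M := by gcongr
    have h2 : 0 ≤ t ^ p / p * B := by positivity
    linarith
  · have ht0 : 0 < t := hr0.trans_lt h
    have h1 : p * M / (2 * B) ≤ t ^ (p - 2) :=
      hrp ▸ Real.rpow_le_rpow hr0 h.le hq.le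
    have h2 : t ^ p = t ^ 2 * t ^ (p - 2) := by
      rw [← Real.rpow_natCast t 2, ← Real.rpow_add ht0]
      norm_num
    have h3 : t ^ 2 / 2 * M ≤ t ^ p / p * B := by
      calc t ^ 2 / 2 * M = t ^ 2 * (p * M / (2 * B)) / p * B := by field_simp
        _ ≤ t ^ 2 * t ^ (p - 2) / p * B := by gcongr
        _ = t ^ p / p * B := by rw [h2]
    have h4 : 0 ≤ r ^ 2 / 2 * M := by positivity
    linarith

/-- The value of the fibering map `λ ↦ (λ²/2) M - (λ^p/p) B` at its critical point
`(M / B)^(1 / (p - 2))`. -/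
theorem fibering_critical_value {p M B : ℝ} (hp : 2 < p) (hM : 0 < M) (hB : 0 < B) :
    ((M / B) ^ (1 / (p - 2))) ^ 2 / 2 * M - ((M / B) ^ (1 / (p - 2))) ^ p / p * B =
      (p - 2) / (2 * p) * (M / B ^ (2 / p)) ^ (p / (p - 2)) := by
  have hp0 : 0 < p := by linarith
  have hq : 0 < p - 2 := by linarith
  have hMB : 0 < M / B := div_pos hM hB
  have h1 : ((M / B) ^ (1 / (p - 2))) ^ 2 = (M / B) ^ (2 / (p - 2)) := by
    rw [← Real.rpow_natCast, ← Real.rpow_mul hMB.le]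
    congr 1
    push_cast
    ring
  have h2 : ((M / B) ^ (1 / (p - 2))) ^ p = (M / B) ^ (2 / (p - 2)) * (M / B) := by
    rw [← Real.rpow_mul hMB.le, ← Real.rpow_add_one hMB.ne']
    congr 1
    field_simp
    ring
  have h3 : (M / B ^ (2 / p)) ^ (p / (p - 2)) = (M / B) ^ (2 / (p - 2)) * M := by
    have e1 : p / (p - 2) = 2 / (p - 2) + 1 := by
      field_simp
      ring
    have e2 : 2 / p * (p / (p - 2)) = 2 / (p - 2) := by field_simp
    rw [Real.div_rpow hM.le (by positivity), ← Real.rpow_mul hB.le, e2, e1,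
      Real.rpow_add_one hM.ne', Real.div_rpow hM.le hB.le]
    ring
  rw [h1, h2, h3]
  field_simp

/-- The lower bound `d(t) ≥ d₁ > 0` of Lemma 3.1: if the embedding constant `C*` works for
all admissible `v`, and `v` is admissible with `∫₀^ℓ x|v|^p dx > 0`, `κ ≥ l`, `G ≥ 0`, then
`sup_{λ≥0} [(λ²/2)(κ∫ x v'² + G) − (λ^p/p)∫ x|v|^p] ≥ d₁ = ((p−2)/(2p))(l/C*^{2/p})^{p/(p−2)}`. -/
theorem potential_depth_lower_bound (ℓ p l Cstar : ℝ) (hℓ : 0 < ℓ) (hp2 : 2 < p) (hp4 : p < 4)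
    (hl0 : 0 < l) (hl1 : l ≤ 1) (hC : 0 < Cstar)
    (hCs : ∀ w : ℝ → ℝ, ContDiffOn ℝ 1 w (Set.Icc 0 ℓ) → w ℓ = 0 →
      (∫ x in (0:ℝ)..ℓ, x * |w x| ^ p) ≤
        Cstar * (∫ x in (0:ℝ)..ℓ, x * (deriv w x) ^ 2) ^ (p / 2))
    (v : ℝ → ℝ) (hv : ContDiffOn ℝ 1 v (Set.Icc 0 ℓ)) (hvℓ : v ℓ = 0)
    (hvpos : 0 < ∫ x in (0:ℝ)..ℓ, x * |v x| ^ p)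
    (κ G : ℝ) (hκ : l ≤ κ) (hG : 0 ≤ G) :
    (p - 2) / (2 * p) * (l / Cstar ^ (2 / p)) ^ (p / (p - 2)) ≤
      sSup {y : ℝ | ∃ lam : ℝ, 0 ≤ lam ∧
        y = lam ^ 2 / 2 * (κ * (∫ x in (0:ℝ)..ℓ, x * (deriv v x) ^ 2) + G)
            - lam ^ p / p * ∫ x in (0:ℝ)..ℓ, x * |v x| ^ p} := by
  have hp0 : 0 < p := by linarith
  have hq : 0 < p - 2 := by linarith
  have hemb := hCs v hv hvℓ
  have hA0 : 0 ≤ ∫ x in (0:ℝ)..ℓ, x * (deriv v x) ^ 2 :=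
    intervalIntegral.integral_nonneg hℓ.le fun x hx => mul_nonneg hx.1 (sq_nonneg _)
  set A := ∫ x in (0:ℝ)..ℓ, x * (deriv v x) ^ 2
  set B := ∫ x in (0:ℝ)..ℓ, x * |v x| ^ p
  have hA : 0 < A := by
    refine hA0.lt_of_ne fun h => ?_
    rw [← h, Real.zero_rpow (by positivity), mul_zero] at hemb
    linarith
  have hlM : l * A ≤ κ * A + G := by
    have := mul_le_mul_of_nonneg_right hκ hA0
    linarith
  have hM : 0 < κ * A + G := (mul_pos hl0 hA).trans_le hlM
  have hroot : B ^ (2 / p) ≤ Cstar ^ (2 / p) * A := by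
    calc B ^ (2 / p) ≤ (Cstar * A ^ (p / 2)) ^ (2 / p) :=
          Real.rpow_le_rpow hvpos.le hemb (by positivity)
      _ = Cstar ^ (2 / p) * A := by
          rw [Real.mul_rpow hC.le (by positivity), ← Real.rpow_mul hA0,
            show p / 2 * (2 / p) = 1 by field_simp, Real.rpow_one]
  have hratio : l / Cstar ^ (2 / p) ≤ (κ * A + G) / B ^ (2 / p) := by
    rw [div_le_div_iff₀ (by positivity) (by positivity)]
    calc l * B ^ (2 / p) ≤ l * (Cstar ^ (2 / p) * A) := by gcongr
      _ = l * A * Cstar ^ (2 / p) := by ring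
      _ ≤ (κ * A + G) * Cstar ^ (2 / p) := by gcongr
  calc (p - 2) / (2 * p) * (l / Cstar ^ (2 / p)) ^ (p / (p - 2))
      ≤ (p - 2) / (2 * p) * ((κ * A + G) / B ^ (2 / p)) ^ (p / (p - 2)) := by gcongr
    _ ≤ _ := le_csSup (bddAbove_fibering hp2 hM.le hvpos)
        ⟨((κ * A + G) / B) ^ (1 / (p - 2)), by positivity,
          (fibering_critical_value hp2 hM hvpos).symm⟩
end

section
/- Let 1 < r < 3/2 and define ξ(t) = 2(r−1)/(t+1)^{3−2r} + 1/(t+1) for t ≥ 0. Let g : [0,∞) → (0,∞) be differentiable with g'(t) ≤ −ξ(t)·g(t)^r for all t > 0. Then for all t ≥ 0, g(t) ≤ ( g(0)^{1−r} + (r−1)·[ (t+1)^{2(r−1)} + ln(t+1) − 1 ] )^{−1/(r−1)}. In particular there is a constant C > 0 with g(t) ≤ C/[ (t+1)^{2(r−1)} + ln(t+1) − 1 ]^{1/(r−1)} for all t ≥ 1. -/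
open Real

/-- A Bernoulli-type comparison: if `g > 0` satisfies `g' ≤ -ξ g ^ r` with `r > 1`, and `X ≥ 0` is
the primitive of `ξ` vanishing at `0`, then `g` is bounded by the solution of the equality case. -/
theorem le_rpow_of_deriv_le_neg_mul_rpow {r : ℝ} (hr : 1 < r) {g ξ X : ℝ → ℝ}
    (hpos : ∀ t, 0 ≤ t → 0 < g t) (hdiff : ∀ t, 0 ≤ t → DifferentiableAt ℝ g t)
    (hg' : ∀ t, 0 < t → deriv g t ≤ -ξ t * g t ^ r)
    (hX : ∀ t, 0 ≤ t → HasDerivAt X (ξ t) t) (hX0 : X 0 = 0) {t : ℝ} (ht : 0 ≤ t)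
    (hXt : 0 ≤ X t) :
    g t ≤ (g 0 ^ (1 - r) + (r - 1) * X t) ^ (-(1 / (r - 1))) := by
  have hderiv : ∀ s, 0 ≤ s → HasDerivAt (fun s ↦ g s ^ (1 - r) - (r - 1) * X s)
      (deriv g s * (1 - r) * g s ^ (1 - r - 1) - (r - 1) * ξ s) s := fun s hs ↦
    ((hdiff s hs).hasDerivAt.rpow_const (Or.inl (hpos s hs).ne')).sub ((hX s hs).const_mul _)
  have hmono : MonotoneOn (fun s ↦ g s ^ (1 - r) - (r - 1) * X s) (Set.Ici 0) := by
    refine monotoneOn_of_deriv_nonneg (convex_Ici 0)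
      (fun s hs ↦ (hderiv s hs).continuousAt.continuousWithinAt) ?_ ?_
    · intro s hs
      exact (hderiv s (interior_subset hs)).differentiableAt.differentiableWithinAt
    · intro s hs
      rw [interior_Ici] at hs
      have hs : 0 < s := hs
      rw [(hderiv s hs.le).deriv]
      have hgs := hpos s hs.le
      have hcancel : g s ^ r * g s ^ (1 - r - 1) = 1 := by
        rw [← rpow_add hgs]
        simp
      have hmul := mul_le_mul_of_nonneg_right (hg' s hs) (rpow_nonneg hgs.le (1 - r - 1))
      rw [mul_assoc, hcancel, mul_one] at hmul
      nlinarith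
  have hle : g 0 ^ (1 - r) + (r - 1) * X t ≤ g t ^ (1 - r) := by
    have h := hmono Set.self_mem_Ici ht ht
    simp only [hX0] at h
    linarith
  have hr' : 0 < r - 1 := sub_pos.2 hr
  have hbase : 0 < g 0 ^ (1 - r) + (r - 1) * X t :=
    add_pos_of_pos_of_nonneg (rpow_pos_of_pos (hpos 0 le_rfl) _) (mul_nonneg hr'.le hXt)
  calc g t = (g t ^ (1 - r)) ^ (-(1 / (r - 1))) := by
        rw [← rpow_mul (hpos t ht).le, show (1 - r) * -(1 / (r - 1)) = 1 by field_simp; ring,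
          rpow_one]
    _ ≤ _ := rpow_le_rpow_of_nonpos hbase hle (neg_nonpos.2 (by positivity))

/-- Remark 5: for `ξ(t) = 2(r−1)/(t+1)^{3−2r} + 1/(t+1)` and `g' ≤ −ξ g^r` with
`1 < r < 3/2`, one gets the logarithmically-corrected polynomial decay
`g(t) ≤ (g(0)^{1−r} + (r−1)[(t+1)^{2(r−1)} + ln(t+1) − 1])^{−1/(r−1)}`, and in particular
`g(t) ≤ C/[(t+1)^{2(r−1)} + ln(t+1) − 1]^{1/(r−1)}` for `t ≥ 1`. -/
theorem remark5_decay (r : ℝ) (hr1 : 1 < r) (hr2 : r < 3 / 2) (g : ℝ → ℝ)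
    (hgpos : ∀ t : ℝ, 0 ≤ t → 0 < g t)
    (hgdiff : ∀ t : ℝ, 0 ≤ t → DifferentiableAt ℝ g t)
    (hg' : ∀ t : ℝ, 0 < t →
      deriv g t ≤ -(2 * (r - 1) / (t + 1) ^ (3 - 2 * r) + 1 / (t + 1)) * g t ^ r) :
    (∀ t : ℝ, 0 ≤ t →
      g t ≤ (g 0 ^ (1 - r)
          + (r - 1) * ((t + 1) ^ (2 * (r - 1)) + Real.log (t + 1) - 1)) ^ (-(1 / (r - 1))))
    ∧ ∃ C > (0:ℝ), ∀ t : ℝ, 1 ≤ t →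
        g t ≤ C / ((t + 1) ^ (2 * (r - 1)) + Real.log (t + 1) - 1) ^ (1 / (r - 1)) := by
  have hr' : 0 < r - 1 := sub_pos.2 hr1
  have hderiv : ∀ t : ℝ, 0 ≤ t →
      HasDerivAt (fun t ↦ (t + 1) ^ (2 * (r - 1)) + Real.log (t + 1) - 1)
        (2 * (r - 1) / (t + 1) ^ (3 - 2 * r) + 1 / (t + 1)) t := by
    intro t ht
    have ht1 : 0 < t + 1 := by linarith
    have hid : HasDerivAt (fun t : ℝ ↦ t + 1) 1 t := (hasDerivAt_id t).add_const 1
    refine (((hid.rpow_const (p := 2 * (r - 1)) (Or.inl ht1.ne')).add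
      (hid.log ht1.ne')).sub_const 1).congr_deriv ?_
    rw [show 2 * (r - 1) - 1 = -(3 - 2 * r) by ring, rpow_neg ht1.le]
    ring
  have hone : ∀ t : ℝ, 0 ≤ t → 1 ≤ (t + 1) ^ (2 * (r - 1)) := fun t ht ↦
    one_le_rpow (by linarith) (by linarith)
  have hmain : ∀ t : ℝ, 0 ≤ t →
      g t ≤ (g 0 ^ (1 - r)
          + (r - 1) * ((t + 1) ^ (2 * (r - 1)) + Real.log (t + 1) - 1)) ^ (-(1 / (r - 1))) := by
    intro t ht
    refine le_rpow_of_deriv_le_neg_mul_rpow hr1 hgpos hgdiff hg' hderiv (by simp) ht ?_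
    linarith [hone t ht, log_nonneg (by linarith : 1 ≤ t + 1)]
  refine ⟨hmain, (r - 1) ^ (-(1 / (r - 1))), rpow_pos_of_pos hr' _, fun t ht ↦ ?_⟩
  have ht0 : 0 ≤ t := by linarith
  have hE : 0 < (t + 1) ^ (2 * (r - 1)) + Real.log (t + 1) - 1 := by
    linarith [hone t ht0, log_pos (by linarith : 1 < t + 1)]
  rw [div_eq_mul_inv, ← rpow_neg hE.le, ← mul_rpow hr'.le hE.le]
  refine (hmain t ht0).trans (rpow_le_rpow_of_nonpos (mul_pos hr' hE) ?_
    (neg_nonpos.2 (by positivity)))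
  exact le_add_of_nonneg_left (rpow_nonneg (hgpos 0 le_rfl).le _)
end
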